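/- arXiv:2306.03800 — 4 statements merged into one kernel-verified Lean document; each statement's English description precedes it below -/
import Mathlib

section
/- Let d ≥ 2 be an integer and let μ : [0,∞) → ℝ be continuous with |μ(e)| ≤ C(1+e)^{-n₁} for some n₁ > d/2 + 1 (so that p ↦ μ(|p|²) is integrable on ℝ^d). Define φ(u) := ∫_{ℝ^{d-1}} μ(u² + |w|²) dw and φ̂(t) := ∫_ℝ e^{iut} φ(u) du. Then for every k ∈ ℝ^d with k ≠ 0 and every λ ∈ ℂ with Re λ > 0, one has the identity i ∫_{ℝ^d} (μ(|p|²) − μ(|k−p|²)) / (λ − 2i k·p + i|k|²) dp = 2 ∫_0^∞ e^{-λ t} sin(t|k|²) φ̂(2t|k|) dt, both integrals converging absolutely. -/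
open MeasureTheory
open scoped RealInnerProductSpace

/-- The marginal of `μ(|p|²)` over a hyperplane in `ℝ^d`. -/
noncomputable def phiMarg (d : ℕ) (μ : ℝ → ℝ) (u : ℝ) : ℝ :=
  ∫ w : EuclideanSpace ℝ (Fin (d - 1)), μ (u ^ 2 + ‖w‖ ^ 2)

/-- The Fourier transform `φ̂(t) = ∫_ℝ e^{iut} φ(u) du`. -/
noncomputable def fourierPhi (φ : ℝ → ℝ) (t : ℝ) : ℂ :=
  ∫ u : ℝ, Complex.exp (Complex.I * u * t) * (φ u : ℂ)

theorem aux_T (m : ℕ) (k : EuclideanSpace ℝ (Fin (m + 1))) (hk : k ≠ 0) :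
    ∃ T : (ℝ × EuclideanSpace ℝ (Fin m)) ≃ᵐ EuclideanSpace ℝ (Fin (m + 1)),
      MeasurePreserving T volume volume ∧ (∀ z, ‖T z‖ ^ 2 = z.1 ^ 2 + ‖z.2‖ ^ 2) ∧
      ∀ z, ⟪k, T z⟫ = ‖k‖ * z.1 := by
  have hk' : ‖k‖ ≠ 0 := norm_ne_zero_iff.mpr hk
  obtain ⟨b, hb⟩ := Orthonormal.exists_orthonormalBasis_extension_of_card_eq (𝕜 := ℝ)
    (E := EuclideanSpace ℝ (Fin (m + 1))) (ι := Fin (m + 1)) (by simp)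
    (v := fun _ => (‖k‖⁻¹ : ℝ) • k) (s := {0}) (by
      rw [orthonormal_iff_ite]
      rintro ⟨i, hi⟩ ⟨j, hj⟩
      have hi' : i = 0 := hi
      have hj' : j = 0 := hj
      subst hi' hj'
      simp only [Set.domRestrict_apply, if_true]
      rw [real_inner_self_eq_norm_sq, norm_smul, norm_inv, norm_norm, inv_mul_cancel₀ hk', one_pow])
  have hb0 : b 0 = (‖k‖⁻¹ : ℝ) • k := hb 0 rfl
  have hkb : k = ‖k‖ • b 0 := by rw [hb0, smul_smul, mul_inv_cancel₀ hk', one_smul]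
  let T := ((((MeasurableEquiv.refl ℝ).prodCongr (MeasurableEquiv.toLp 2 (Fin m → ℝ)).symm).trans
    (MeasurableEquiv.piFinSuccAbove (fun _ : Fin (m + 1) => ℝ) 0).symm).trans
    (MeasurableEquiv.toLp 2 (Fin (m + 1) → ℝ))).trans b.measurableEquiv.symm
  have hT : ∀ z, T z = b.repr.symm (WithLp.toLp 2 (Fin.cons z.1 z.2.ofLp)) := by
    intro z
    change b.repr.symm (WithLp.toLp 2 (Fin.insertNth 0 z.1 z.2.ofLp)) = _
    rw [Fin.insertNth_zero']
  refine ⟨T, ?_, ?_, ?_⟩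
  · refine MeasurePreserving.trans (MeasurePreserving.trans (MeasurePreserving.trans ?_
      (volume_preserving_piFinSuccAbove (fun _ : Fin (m + 1) => ℝ) 0).symm)
      (PiLp.volume_preserving_toLp (Fin (m + 1)))) b.measurePreserving_measurableEquiv.symm
    exact (MeasurePreserving.id volume).prod (PiLp.volume_preserving_ofLp (Fin m))
  · intro z
    rw [hT, LinearIsometryEquiv.norm_map, EuclideanSpace.real_norm_sq_eq, Fin.sum_univ_succ,
      EuclideanSpace.real_norm_sq_eq]
    simp
  · intro z
    rw [hT]
    conv_lhs => rw [hkb]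
    rw [real_inner_smul_left, ← b.repr_apply_apply]
    simp

theorem aux_marg (m : ℕ) (μ : ℝ → ℝ) (k : EuclideanSpace ℝ (Fin (m + 1))) (hk : k ≠ 0)
    (hF : Integrable (fun p : EuclideanSpace ℝ (Fin (m + 1)) => ((μ (‖p‖ ^ 2) : ℝ) : ℂ)))
    (s : ℝ) :
    ∫ p : EuclideanSpace ℝ (Fin (m + 1)),
      Complex.exp (Complex.I * s * (⟪k, p⟫ : ℝ)) * ((μ (‖p‖ ^ 2) : ℝ) : ℂ) =
    fourierPhi (phiMarg (m + 1) μ) (s * ‖k‖) := by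
  obtain ⟨T, hT, hn, hi⟩ := aux_T m k hk
  have hint : Integrable (fun p : EuclideanSpace ℝ (Fin (m + 1)) =>
      Complex.exp (Complex.I * s * (⟪k, p⟫ : ℝ)) * ((μ (‖p‖ ^ 2) : ℝ) : ℂ)) := by
    refine hF.bdd_mul (c := 1) (Continuous.aestronglyMeasurable (by fun_prop)) (.of_forall ?_)
    intro p
    rw [Complex.norm_exp]
    simp
  have hint2 := (hT.integrable_comp_emb T.measurableEmbedding).mpr hint
  rw [← hT.integral_comp T.measurableEmbedding]
  rw [Measure.volume_eq_prod] at hint2 ⊢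
  refine (integral_prod _ hint2).trans ?_
  simp only [Function.comp]
  unfold fourierPhi phiMarg
  refine integral_congr_ae (.of_forall fun u => ?_)
  simp only [hn, hi]
  rw [integral_const_mul]
  congr 1
  · congr 1
    push_cast
    ring
  · exact integral_ofReal

theorem aux_int (d : ℕ) (μ : ℝ → ℝ) (C n₁ : ℝ)
    (hcont : Continuous μ)
    (hn₁ : (d : ℝ) / 2 + 1 < n₁)
    (hdecay : ∀ e : ℝ, 0 ≤ e → |μ e| ≤ C * (1 + e) ^ (-n₁)) :
    Integrable (fun p : EuclideanSpace ℝ (Fin d) => ((μ (‖p‖ ^ 2) : ℝ) : ℂ)) := by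
  have h := integrable_rpow_neg_one_add_norm_sq (E := EuclideanSpace ℝ (Fin d)) (μ := volume)
    (r := 2 * n₁) (by simp; linarith)
  refine Integrable.ofReal ((h.const_mul C).mono' (Continuous.aestronglyMeasurable (by fun_prop))
    (.of_forall fun p => ?_))
  have := hdecay (‖p‖ ^ 2) (by positivity)
  rw [Real.norm_eq_abs]
  convert this using 3
  ring

theorem stmt2 (d : ℕ) (hd : 2 ≤ d) (μ : ℝ → ℝ) (C n₁ : ℝ)
    (hcont : Continuous μ)
    (hn₁ : (d : ℝ) / 2 + 1 < n₁)
    (hdecay : ∀ e : ℝ, 0 ≤ e → |μ e| ≤ C * (1 + e) ^ (-n₁))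
    (k : EuclideanSpace ℝ (Fin d)) (hk : k ≠ 0)
    (lam : ℂ) (hlam : 0 < lam.re) :
    Integrable (fun p : EuclideanSpace ℝ (Fin d) =>
      ((μ (‖p‖ ^ 2) - μ (‖k - p‖ ^ 2) : ℝ) : ℂ) /
        (lam - 2 * Complex.I * (⟪k, p⟫ : ℂ) + Complex.I * (‖k‖ : ℂ) ^ 2)) ∧
    IntegrableOn (fun t : ℝ =>
      Complex.exp (-lam * t) * (Real.sin (t * ‖k‖ ^ 2) : ℂ) *
        fourierPhi (phiMarg d μ) (2 * t * ‖k‖)) (Set.Ioi 0) ∧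
    Complex.I * (∫ p : EuclideanSpace ℝ (Fin d),
      ((μ (‖p‖ ^ 2) - μ (‖k - p‖ ^ 2) : ℝ) : ℂ) /
        (lam - 2 * Complex.I * (⟪k, p⟫ : ℂ) + Complex.I * (‖k‖ : ℂ) ^ 2)) =
    2 * ∫ t in Set.Ioi (0 : ℝ),
      Complex.exp (-lam * t) * (Real.sin (t * ‖k‖ ^ 2) : ℂ) *
        fourierPhi (phiMarg d μ) (2 * t * ‖k‖) := by
  obtain ⟨m, rfl⟩ : ∃ m, d = m + 1 := ⟨d - 1, by omega⟩
  have hF := aux_int (m + 1) μ C n₁ hcont hn₁ hdecay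
  have hF2 : Integrable (fun p : EuclideanSpace ℝ (Fin (m + 1)) =>
      ((μ (‖k - p‖ ^ 2) : ℝ) : ℂ)) := hF.comp_sub_left k
  have hG : Integrable (fun p : EuclideanSpace ℝ (Fin (m + 1)) =>
      ((μ (‖p‖ ^ 2) - μ (‖k - p‖ ^ 2) : ℝ) : ℂ)) := by
    refine (hF.sub hF2).congr (.of_forall fun p => ?_)
    simp
  have hneg : (-lam).re < 0 := by simpa using hlam
  let H : EuclideanSpace ℝ (Fin (m + 1)) → ℝ → ℂ := fun p t =>
    ((μ (‖p‖ ^ 2) - μ (‖k - p‖ ^ 2) : ℝ) : ℂ) * Complex.exp (-lam * t) *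
      Complex.exp (((-(‖k‖ ^ 2 - 2 * ⟪k, p⟫) * t : ℝ) : ℂ) * Complex.I)
  have hH : Integrable (Function.uncurry H)
      ((volume : Measure (EuclideanSpace ℝ (Fin (m + 1)))).prod
        (volume.restrict (Set.Ioi (0 : ℝ)))) := by
    refine (hG.mul_prod (integrableOn_exp_mul_complex_Ioi hneg 0)).mul_bdd (c := 1)
      (Continuous.aestronglyMeasurable (by fun_prop)) (.of_forall fun z => ?_)
    rw [Complex.norm_exp_ofReal_mul_I]
  have hHt : ∀ p, ∫ t in Set.Ioi (0 : ℝ), H p t =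
      ((μ (‖p‖ ^ 2) - μ (‖k - p‖ ^ 2) : ℝ) : ℂ) /
        (lam - 2 * Complex.I * (⟪k, p⟫ : ℂ) + Complex.I * (‖k‖ : ℂ) ^ 2) := by
    intro p
    let a : ℂ := -(lam - 2 * Complex.I * (⟪k, p⟫ : ℂ) + Complex.I * (‖k‖ : ℂ) ^ 2)
    have ha : a.re < 0 := by
      simp only [a]
      rw [← Complex.ofReal_pow]
      simp only [Complex.neg_re, Complex.add_re, Complex.sub_re, Complex.mul_re, Complex.mul_im,
        Complex.I_re, Complex.I_im, Complex.ofReal_re, Complex.ofReal_im, Complex.re_ofNat,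
        Complex.im_ofNat]
      linarith
    have h1 : ∀ t : ℝ, H p t = ((μ (‖p‖ ^ 2) - μ (‖k - p‖ ^ 2) : ℝ) : ℂ) *
        Complex.exp (a * t) := by
      intro t
      simp only [H, a]
      rw [mul_assoc, ← Complex.exp_add]
      congr 2
      push_cast
      ring
    simp only [h1]
    rw [integral_const_mul, integral_exp_mul_complex_Ioi ha]
    simp only [a, Complex.ofReal_zero, mul_zero, Complex.exp_zero, neg_div_neg_eq, mul_one_div]
  have hHp : ∀ t : ℝ, ∫ p, H p t = (-2 * Complex.I) *
      (Complex.exp (-lam * t) * (Real.sin (t * ‖k‖ ^ 2) : ℂ) *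
        fourierPhi (phiMarg (m + 1) μ) (2 * t * ‖k‖)) := by
    intro t
    rw [← aux_marg m μ k hk hF (2 * t)]
    let E : EuclideanSpace ℝ (Fin (m + 1)) → ℂ := fun p =>
      Complex.exp (Complex.I * (2 * t : ℝ) * (⟪k, p⟫ : ℝ))
    have hb : ∀ f : EuclideanSpace ℝ (Fin (m + 1)) → ℂ, Integrable f →
        Integrable (fun p => E p * f p) := by
      intro f hf
      refine hf.bdd_mul (c := 1) (Continuous.aestronglyMeasurable (by fun_prop)) (.of_forall ?_)
      intro p
      simp only [E]
      rw [Complex.norm_exp]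
      simp
    have h1 : ∀ p, H p t = Complex.exp (-lam * t) *
        Complex.exp (-(t * ‖k‖ ^ 2 : ℝ) * Complex.I) *
        (E p * ((μ (‖p‖ ^ 2) : ℝ) : ℂ) - E p * ((μ (‖k - p‖ ^ 2) : ℝ) : ℂ)) := by
      intro p
      have : Complex.exp (((-(‖k‖ ^ 2 - 2 * ⟪k, p⟫) * t : ℝ) : ℂ) * Complex.I) =
          Complex.exp (-(t * ‖k‖ ^ 2 : ℝ) * Complex.I) * E p := by
        simp only [E]
        rw [← Complex.exp_add]
        congr 1
        push_cast
        ring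
      simp only [H]
      rw [this]
      push_cast
      ring
    have h2 : ∫ p, E p * ((μ (‖k - p‖ ^ 2) : ℝ) : ℂ) =
        Complex.exp (2 * (t * ‖k‖ ^ 2 : ℝ) * Complex.I) *
          ∫ p, E p * ((μ (‖p‖ ^ 2) : ℝ) : ℂ) := by
      rw [← integral_add_right_eq_self _ k, ← integral_const_mul]
      refine integral_congr_ae (.of_forall fun p => ?_)
      have hp : ‖k - (p + k)‖ = ‖p‖ := by
        rw [show k - (p + k) = -p by abel, norm_neg]
      simp only [hp, E]
      rw [← mul_assoc, ← Complex.exp_add, inner_add_right, real_inner_self_eq_norm_sq]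
      congr 2
      push_cast
      ring
    simp only [h1]
    rw [integral_const_mul, integral_sub (hb _ hF) (hb _ hF2), h2]
    change _ = -2 * Complex.I * (_ * _ * ∫ p, E p * ((μ (‖p‖ ^ 2) : ℝ) : ℂ))
    generalize (∫ p, E p * ((μ (‖p‖ ^ 2) : ℝ) : ℂ)) = J
    rw [Complex.ofReal_sin, Complex.sin]
    have h3 : Complex.exp (2 * (t * ‖k‖ ^ 2 : ℝ) * Complex.I) =
        Complex.exp ((t * ‖k‖ ^ 2 : ℝ) * Complex.I) *
        Complex.exp ((t * ‖k‖ ^ 2 : ℝ) * Complex.I) := by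
      rw [← Complex.exp_add]; congr 1; ring
    have h4 : Complex.exp (-(t * ‖k‖ ^ 2 : ℝ) * Complex.I) *
        Complex.exp ((t * ‖k‖ ^ 2 : ℝ) * Complex.I) = 1 := by
      rw [← Complex.exp_add, neg_mul, neg_add_cancel, Complex.exp_zero]
    rw [h3]
    generalize Complex.exp (-(t * ‖k‖ ^ 2 : ℝ) * Complex.I) = A at *
    generalize Complex.exp ((t * ‖k‖ ^ 2 : ℝ) * Complex.I) = B at *
    linear_combination (-Complex.exp (-lam * t) * B * J) * h4 +
      (Complex.exp (-lam * t) * (A - B) * J) * Complex.I_sq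
  have hI1 := hH.integral_prod_left
  have hI2 := hH.integral_prod_right
  have hsw := integral_integral_swap hH
  simp only [Function.uncurry, hHt, hHp] at hI1 hI2 hsw
  refine ⟨hI1, ?_, ?_⟩
  · have h5 := hI2.const_mul (Complex.I / 2)
    refine h5.congr (.of_forall fun t => ?_)
    simp only
    linear_combination (-(Complex.exp (-lam * t) * (Real.sin (t * ‖k‖ ^ 2) : ℂ) *
        fourierPhi (phiMarg (m + 1) μ) (2 * t * ‖k‖))) * Complex.I_sq
  · rw [hsw, integral_const_mul]
    linear_combination (-2 * ∫ t in Set.Ioi (0 : ℝ),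
      Complex.exp (-lam * t) * (Real.sin (t * ‖k‖ ^ 2) : ℂ) *
        fourierPhi (phiMarg (m + 1) μ) (2 * t * ‖k‖)) * Complex.I_sq
end

section
/- Let φ : ℝ → [0,∞) be even, continuously differentiable and integrable, and suppose there is Υ ∈ (0,∞] such that φ'(u) < 0 for 0 < u < Υ and φ(u) = 0 for |u| ≥ Υ. Define H(z) := ∫_ℝ φ(u)/(z − u) du for Im z < 0. Then for every κ > 0 and every z ∈ ℂ with Im z < 0, the number H(z) − H(z + κ) is never a positive real number; more precisely, if Im(H(z) − H(z+κ)) = 0 then Re(H(z) − H(z+κ)) < 0. Consequently, for every integer d ≥ 2, every k ∈ ℝ^d with k ≠ 0 and every λ ∈ ℂ with Re λ > 0, the dielectric function D(λ,k) := 1 + (|k|^{-2}/(2|k|)) [ H((−iλ + |k|²)/(2|k|)) − H((−iλ − |k|²)/(2|k|)) ] is nonzero. -/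
open MeasureTheory ENNReal

/-- The Cauchy integral `H(z) = ∫_ℝ φ(u)/(z − u) du`. -/
noncomputable def Hcauchy (φ : ℝ → ℝ) (z : ℂ) : ℂ :=
  ∫ u : ℝ, (φ u : ℂ) / (z - (u : ℂ))

/-- The Coulomb dielectric function
`D(λ,k) = 1 + (|k|⁻²/(2|k|)) [H((−iλ+|k|²)/(2|k|)) − H((−iλ−|k|²)/(2|k|))]`. -/
noncomputable def Dcoulomb {d : ℕ} (φ : ℝ → ℝ) (lam : ℂ)
    (k : EuclideanSpace ℝ (Fin d)) : ℂ :=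
  1 + (((‖k‖ : ℂ) ^ 2)⁻¹ / (2 * (‖k‖ : ℂ))) *
    (Hcauchy φ ((-Complex.I * lam + (‖k‖ : ℂ) ^ 2) / (2 * (‖k‖ : ℂ))) -
     Hcauchy φ ((-Complex.I * lam - (‖k‖ : ℂ) ^ 2) / (2 * (‖k‖ : ℂ))))

lemma aux_dec (φ : ℝ → ℝ) (Υ : ℝ≥0∞) (hpos : ∀ u : ℝ, 0 ≤ φ u)
    (hC1 : ContDiff ℝ 1 φ)
    (hmono : ∀ u : ℝ, 0 < u → ENNReal.ofReal u < Υ → deriv φ u < 0)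
    (u v : ℝ) (hu : 0 ≤ u) (huv : u < v) (hv : ENNReal.ofReal v < Υ) : φ v < φ u := by
  have h : StrictAntiOn φ (Set.Icc 0 v) := by
    apply strictAntiOn_of_deriv_neg (convex_Icc 0 v) hC1.continuous.continuousOn
    intro x hx
    rw [interior_Icc] at hx
    exact hmono x hx.1 (lt_of_le_of_lt (ENNReal.ofReal_le_ofReal hx.2.le) hv)
  exact h ⟨hu, huv.le⟩ ⟨hu.trans huv.le, le_rfl⟩ huv

lemma aux_pos (φ g : ℝ → ℝ) (s C : ℝ) (hc : Continuous φ) (hint : Integrable φ)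
    (hle : ∀ u v : ℝ, |u| ≤ |v| → φ v ≤ φ u) (hlt : φ s < φ 0) (hs : 0 < s)
    (hg : Continuous g) (hC : ∀ u, |g u| ≤ C) (hodd : ∀ u, g (s - u) = - g u)
    (hg0 : ∀ u, u ≤ s / 2 → 0 ≤ g u) (hg1 : 0 < g 0) : 0 < ∫ u, φ u * g u := by
  have hi1 : Integrable (fun u => φ u * g u) :=
    hint.mul_bdd hg.aestronglyMeasurable (Filter.Eventually.of_forall hC)
  have hi2 : Integrable (fun u => φ (s - u) * g u) :=
    (hint.comp_sub_left s).mul_bdd hg.aestronglyMeasurable (Filter.Eventually.of_forall hC)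
  have e : ∫ u, φ u * g u = - ∫ u, φ (s - u) * g u := by
    rw [← integral_sub_left_eq_self (fun u => φ u * g u) volume s, ← integral_neg]
    congr 1; ext u; rw [hodd]; ring
  have hp : 0 < ∫ u, (φ u * g u - φ (s - u) * g u) := by
    apply integral_pos_of_integrable_nonneg_nonzero (x := 0)
    · fun_prop
    · exact hi1.sub hi2
    · intro u
      simp only [Pi.zero_apply]
      rcases le_total u (s/2) with h | h
      · have h1 := hg0 u h
        have h2 : φ (s - u) ≤ φ u := hle _ _ (by
          rw [abs_of_nonneg (by linarith : 0 ≤ s - u), abs_le]; constructor <;> linarith)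
        nlinarith
      · have h1 := hg0 (s - u) (by linarith)
        rw [hodd] at h1
        have h2 : φ u ≤ φ (s - u) := hle _ _ (by
          rw [abs_of_nonneg (by linarith : 0 ≤ u), abs_le]; constructor <;> linarith)
        nlinarith
    · simp only [sub_zero]
      have : 0 < (φ 0 - φ s) * g 0 := mul_pos (by linarith) hg1
      nlinarith
  rw [integral_sub hi1 hi2] at hp
  linarith

lemma aux_ne (z : ℂ) (hz : z.im < 0) (u : ℝ) : z - (u : ℂ) ≠ 0 := by
  intro h
  have := congrArg Complex.im h
  simp at this
  linarith

lemma aux_cont (z : ℂ) (hz : z.im < 0) : Continuous (fun u : ℝ => (z - (u : ℂ))⁻¹) :=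
  Continuous.inv₀ (by fun_prop) (aux_ne z hz)

lemma aux_bd (z : ℂ) (hz : z.im < 0) (u : ℝ) : ‖(z - (u : ℂ))⁻¹‖ ≤ (-z.im)⁻¹ := by
  rw [norm_inv]
  apply inv_anti₀ (by linarith)
  have := Complex.abs_im_le_norm (z - (u : ℂ))
  simp at this
  linarith [neg_abs_le z.im]

lemma aux_int_s4 (φ : ℝ → ℝ) (hint : Integrable φ) (z : ℂ) (hz : z.im < 0) :
    Integrable (fun u : ℝ => (φ u : ℂ) / (z - (u : ℂ))) := by
  simp only [div_eq_mul_inv]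
  exact hint.ofReal.mul_bdd (aux_cont z hz).aestronglyMeasurable
    (Filter.Eventually.of_forall (aux_bd z hz))

lemma aux_re (φ : ℝ → ℝ) (hint : Integrable φ) (z : ℂ) (hz : z.im < 0) :
    (Hcauchy φ z).re = ∫ u : ℝ, φ u * ((z - (u : ℂ))⁻¹).re := by
  have := Complex.reCLM.integral_comp_comm (aux_int_s4 φ hint z hz)
  simp only [Complex.reCLM_apply] at this
  rw [Hcauchy, ← this]
  congr 1; ext u; rw [div_eq_mul_inv, Complex.re_ofReal_mul]

lemma aux_im (φ : ℝ → ℝ) (hint : Integrable φ) (z : ℂ) (hz : z.im < 0) :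
    (Hcauchy φ z).im = ∫ u : ℝ, φ u * ((z - (u : ℂ))⁻¹).im := by
  have := Complex.imCLM.integral_comp_comm (aux_int_s4 φ hint z hz)
  simp only [Complex.imCLM_apply] at this
  rw [Hcauchy, ← this]
  congr 1; ext u; rw [div_eq_mul_inv, Complex.im_ofReal_mul]

lemma aux_symm (φ : ℝ → ℝ) (heven : ∀ u : ℝ, φ (-u) = φ u) (z : ℂ) :
    Hcauchy φ (-(starRingEnd ℂ z)) = - (starRingEnd ℂ (Hcauchy φ z)) := by
  rw [Hcauchy, Hcauchy, ← integral_conj, ← integral_neg_eq_self, ← integral_neg]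
  congr 1; ext u
  rw [heven]
  simp only [map_div₀, map_sub, Complex.conj_ofReal, Complex.ofReal_neg]
  rw [← div_neg]; congr 1; ring

lemma aux_impos (φ : ℝ → ℝ) (hc : Continuous φ) (hint : Integrable φ)
    (hle : ∀ u v : ℝ, |u| ≤ |v| → φ v ≤ φ u) (hlt : ∀ s, 0 < s → φ s < φ 0)
    (κ : ℝ) (hκ : 0 < κ) (z : ℂ) (hz : z.im < 0) (hs : 0 < 2 * z.re + κ) :
    0 < (Hcauchy φ z - Hcauchy φ (z + κ)).im := by
  have hz' : (z + κ).im < 0 := by simpa using hz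
  have hb1 : ∀ u : ℝ, |((z - (u : ℂ))⁻¹).im| ≤ (-z.im)⁻¹ := fun u =>
    (Complex.abs_im_le_norm _).trans (aux_bd z hz u)
  have hb2 : ∀ u : ℝ, |((z + κ - (u : ℂ))⁻¹).im| ≤ (-(z+κ).im)⁻¹ := fun u =>
    (Complex.abs_im_le_norm _).trans (aux_bd (z+κ) hz' u)
  have hc1 : Continuous (fun u : ℝ => ((z - (u : ℂ))⁻¹).im) :=
    Complex.continuous_im.comp (aux_cont z hz)
  have hc2 : Continuous (fun u : ℝ => ((z + κ - (u : ℂ))⁻¹).im) :=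
    Complex.continuous_im.comp (aux_cont (z+κ) hz')
  have hy : 0 < z.im * z.im := mul_pos_of_neg_of_neg hz hz
  have key : ∀ u : ℝ, (u - z.re)^2 ≤ (z.re + κ - u)^2 →
      ((z + κ - (u : ℂ))⁻¹).im ≤ ((z - (u : ℂ))⁻¹).im := by
    intro u hu
    simp only [Complex.inv_im, Complex.normSq_apply, Complex.sub_im, Complex.add_im,
      Complex.sub_re, Complex.add_re, Complex.ofReal_re, Complex.ofReal_im, add_zero, sub_zero]
    apply div_le_div_of_nonneg_left (by linarith)
    · nlinarith [mul_self_nonneg (z.re - u)]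
    · nlinarith
  rw [Complex.sub_im, aux_im φ hint z hz, aux_im φ hint _ hz', ← integral_sub
    (hint.mul_bdd hc1.aestronglyMeasurable (Filter.Eventually.of_forall hb1))
    (hint.mul_bdd hc2.aestronglyMeasurable (Filter.Eventually.of_forall hb2))]
  simp only [← mul_sub]
  refine aux_pos φ (fun u => ((z - (u : ℂ))⁻¹).im - ((z + κ - (u : ℂ))⁻¹).im) (2 * z.re + κ)
    ((-z.im)⁻¹ + (-(z+κ).im)⁻¹) hc hint hle (hlt _ hs) hs (hc1.sub hc2) ?_ ?_ ?_ ?_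
  · intro u
    exact (abs_sub _ _).trans (add_le_add (hb1 u) (hb2 u))
  · intro u
    simp only [Complex.inv_im, Complex.normSq_apply, Complex.sub_im, Complex.add_im,
      Complex.sub_re, Complex.add_re, Complex.ofReal_re, Complex.ofReal_im, add_zero, sub_zero]
    rw [neg_sub]
    congr 2 <;> ring
  · intro u hu
    have := key u (by nlinarith)
    linarith
  · simp only [Complex.inv_im, Complex.normSq_apply, Complex.sub_im, Complex.add_im,
      Complex.sub_re, Complex.add_re, Complex.ofReal_re, Complex.ofReal_im, add_zero, sub_zero]
    rw [sub_pos]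
    apply div_lt_div_of_pos_left (by linarith)
    · nlinarith [mul_self_nonneg (z.re)]
    · nlinarith

lemma aux_repos (φ : ℝ → ℝ) (hc : Continuous φ) (hint : Integrable φ)
    (hle : ∀ u v : ℝ, |u| ≤ |v| → φ v ≤ φ u) (hlt : ∀ s, 0 < s → φ s < φ 0)
    (z : ℂ) (hz : z.im < 0) (hs : 0 < z.re) :
    0 < (Hcauchy φ z).re := by
  have hy : 0 < z.im * z.im := mul_pos_of_neg_of_neg hz hz
  rw [aux_re φ hint z hz]
  refine aux_pos φ (fun u => ((z - (u : ℂ))⁻¹).re) (2 * z.re)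
    ((-z.im)⁻¹) hc hint hle (hlt _ (by linarith)) (by linarith)
    (Complex.continuous_re.comp (aux_cont z hz)) ?_ ?_ ?_ ?_
  · intro u
    exact (Complex.abs_re_le_norm _).trans (aux_bd z hz u)
  · intro u
    simp only [Complex.inv_re, Complex.normSq_apply, Complex.sub_im,
      Complex.sub_re, Complex.ofReal_re, Complex.ofReal_im, sub_zero]
    rw [← neg_div]
    congr 1 <;> ring
  · intro u hu
    simp only [Complex.inv_re, Complex.sub_re, Complex.ofReal_re]
    exact div_nonneg (by linarith) (Complex.normSq_nonneg _)
  · simp only [Complex.inv_re, Complex.sub_re, Complex.ofReal_re]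
    exact div_pos (by linarith) (Complex.normSq_pos.2 (aux_ne z hz 0))

theorem stmt4 (φ : ℝ → ℝ) (Υ : ℝ≥0∞) (hΥ : 0 < Υ)
    (hpos : ∀ u : ℝ, 0 ≤ φ u)
    (heven : ∀ u : ℝ, φ (-u) = φ u)
    (hC1 : ContDiff ℝ 1 φ)
    (hint : Integrable φ)
    (hmono : ∀ u : ℝ, 0 < u → ENNReal.ofReal u < Υ → deriv φ u < 0)
    (hsupp : ∀ u : ℝ, Υ ≤ ENNReal.ofReal |u| → φ u = 0) :
    (∀ κ : ℝ, 0 < κ → ∀ z : ℂ, z.im < 0 →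
      (Hcauchy φ z - Hcauchy φ (z + κ)).im = 0 →
      (Hcauchy φ z - Hcauchy φ (z + κ)).re < 0) ∧
    (∀ d : ℕ, 2 ≤ d → ∀ k : EuclideanSpace ℝ (Fin d), k ≠ 0 →
      ∀ lam : ℂ, 0 < lam.re → Dcoulomb φ lam k ≠ 0) := by
  have habs : ∀ u, φ |u| = φ u := by
    intro u
    rcases abs_choice u with h | h <;> rw [h]
    exact heven u
  have hle : ∀ u v : ℝ, |u| ≤ |v| → φ v ≤ φ u := by
    intro u v h
    rcases le_or_gt Υ (ENNReal.ofReal |v|) with h1 | h1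
    · rw [hsupp v h1]; exact hpos u
    · rw [← habs u, ← habs v]
      rcases h.eq_or_lt with h2 | h2
      · rw [h2]
      · exact (aux_dec φ Υ hpos hC1 hmono _ _ (abs_nonneg u) h2 h1).le
  have hlt : ∀ s, 0 < s → φ s < φ 0 := by
    intro s hs
    rcases le_or_gt Υ (ENNReal.ofReal s) with h1 | h1
    · rw [hsupp s (by rwa [abs_of_pos hs])]
      obtain ⟨r, hr0, hr⟩ := ENNReal.lt_iff_exists_nnreal_btwn.1 hΥ
      have : φ r < φ 0 := aux_dec φ Υ hpos hC1 hmono 0 r le_rfl (by exact_mod_cast hr0)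
        (by simpa using hr)
      exact (hpos _).trans_lt this
    · exact aux_dec φ Υ hpos hC1 hmono 0 s le_rfl hs h1
  have hc := hC1.continuous
  have main : ∀ κ : ℝ, 0 < κ → ∀ z : ℂ, z.im < 0 →
      (Hcauchy φ z - Hcauchy φ (z + κ)).im = 0 →
      (Hcauchy φ z - Hcauchy φ (z + κ)).re < 0 := by
    intro κ hκ z hz h0
    rcases lt_trichotomy (2 * z.re + κ) 0 with h | h | h
    · exfalso
      have h3 := aux_impos φ hc hint hle hlt κ hκ (-(starRingEnd ℂ (z + κ))) (by simpa using hz)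
        (by simp; linarith)
      have e : -(starRingEnd ℂ (z + κ)) + (κ : ℂ) = -(starRingEnd ℂ z) := by simp
      rw [e, aux_symm φ heven, aux_symm φ heven] at h3
      simp at h3 h0
      linarith
    · have e : z + κ = -(starRingEnd ℂ z) := by
        apply Complex.ext <;> simp
        linarith
      have h3 := aux_repos φ hc hint hle hlt (z + κ) (by simpa using hz) (by simp; linarith)
      rw [e, aux_symm φ heven] at h3 ⊢
      simp at h3 ⊢
      linarith
    · exact absurd h0 (aux_impos φ hc hint hle hlt κ hκ z hz h).ne'
  refine ⟨main, ?_⟩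
  intro d _ k hk lam hlam hD
  have hk' : 0 < ‖k‖ := norm_pos_iff.2 hk
  have hkc : (‖k‖ : ℂ) ≠ 0 := by exact_mod_cast hk'.ne'
  set z : ℂ := (-Complex.I * lam - (‖k‖ : ℂ) ^ 2) / (2 * (‖k‖ : ℂ)) with hzdef
  have hzk : (-Complex.I * lam + (‖k‖ : ℂ) ^ 2) / (2 * (‖k‖ : ℂ)) = z + (‖k‖ : ℝ) := by
    rw [hzdef]; field_simp; ring
  have hz : z.im < 0 := by
    have e : (2 * (‖k‖ : ℂ)) = ((2 * ‖k‖ : ℝ) : ℂ) := by push_cast; rfl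
    rw [hzdef, e, Complex.div_ofReal_im]
    apply div_neg_of_neg_of_pos _ (by linarith)
    rw [← Complex.ofReal_pow, Complex.sub_im, Complex.ofReal_im]
    simp [hlam]
  have hm := main ‖k‖ hk' z hz
  have hv : Hcauchy φ z - Hcauchy φ (z + (‖k‖ : ℝ)) = ((2 * ‖k‖ ^ 3 : ℝ) : ℂ) := by
    rw [Dcoulomb, hzk, ← hzdef] at hD
    field_simp at hD
    push_cast
    linear_combination -hD
  rw [hv] at hm
  have := hm (Complex.ofReal_im _)
  rw [Complex.ofReal_re] at this
  have : 0 < 2 * ‖k‖ ^ 3 := by positivity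
  linarith
end

section
/- Let d ≥ 2 be an integer and let φ : ℝ → [0,∞) be even, continuously differentiable with φ and φ' integrable, such that for some Υ ∈ (0,∞], φ'(u) < 0 for 0 < u < Υ and φ(u) = 0 for |u| ≥ Υ. Define D(λ,k) for k ≠ 0 and Re λ > 0 as the Coulomb dielectric function. Then for every k ∈ ℝ^d with k ≠ 0 the limit D(0,k) := lim_{γ→0⁺} D(γ, k) exists, is a real number, and satisfies D(0,k) ≥ 1. -/
open MeasureTheory ENNReal

lemma phi_anti (φ : ℝ → ℝ) (Υ : ℝ≥0∞)
    (hpos : ∀ u : ℝ, 0 ≤ φ u) (hC1 : ContDiff ℝ 1 φ)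
    (hmono : ∀ u : ℝ, 0 < u → ENNReal.ofReal u < Υ → deriv φ u < 0)
    (hsupp : ∀ u : ℝ, Υ ≤ ENNReal.ofReal |u| → φ u = 0) (x y : ℝ) (hx : 0 ≤ x) (hxy : x ≤ y) :
    φ y ≤ φ x := by
  by_cases h : Υ ≤ ENNReal.ofReal |y|
  · rw [hsupp y h]; exact hpos x
  · push Not at h
    rw [abs_of_nonneg (hx.trans hxy)] at h
    have : AntitoneOn φ (Set.Icc 0 y) := by
      apply antitoneOn_of_deriv_nonpos (convex_Icc 0 y) hC1.continuous.continuousOn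
      · exact (hC1.differentiable (by norm_num)).differentiableOn
      · intro u hu
        rw [interior_Icc] at hu
        exact (hmono u hu.1 ((ENNReal.ofReal_le_ofReal hu.2.le).trans_lt h)).le
    exact this ⟨hx, hxy⟩ ⟨hx.trans hxy, le_rfl⟩ hxy

lemma g_nonneg (φ : ℝ → ℝ) (heven : ∀ u : ℝ, φ (-u) = φ u)
    (hanti : ∀ x y : ℝ, 0 ≤ x → x ≤ y → φ y ≤ φ x) (a : ℝ) (ha : 0 < a) (v : ℝ) :
    0 ≤ (φ (a - v) - φ (a + v)) * v := by
  have habs : ∀ x, φ |x| = φ x := by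
    intro x
    rcases abs_choice x with h | h <;> rw [h]
    exact heven x
  rcases le_total 0 v with hv | hv
  · apply mul_nonneg _ hv
    have := hanti |a - v| |a + v| (abs_nonneg _) (by
      rw [abs_of_nonneg (by linarith : 0 ≤ a + v), abs_le]; constructor <;> linarith)
    rw [habs, habs] at this; linarith
  · apply mul_nonneg_of_nonpos_of_nonpos _ hv
    have := hanti |a + v| |a - v| (abs_nonneg _) (by
      rw [abs_of_nonneg (by linarith : 0 ≤ a - v), abs_le]; constructor <;> linarith)
    rw [habs, habs] at this; linarith

lemma int_div (ψ : ℝ → ℝ) (hψ : Integrable ψ) (hc : Continuous ψ) (f : ℝ → ℂ) (hf : Continuous f)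
    (ε : ℝ) (hε : 0 < ε) (h : ∀ v, ε ≤ ‖f v‖) :
    Integrable (fun v => (ψ v : ℂ) / f v) := by
  have hne : ∀ v, f v ≠ 0 := fun v => norm_pos_iff.1 (hε.trans_le (h v))
  refine Integrable.mono' (hψ.norm.div_const ε) ?_ ?_
  · exact ((Complex.continuous_ofReal.comp hc).div hf hne).aestronglyMeasurable
  · refine Filter.Eventually.of_forall fun v => ?_
    rw [norm_div, Complex.norm_real]
    exact div_le_div_of_nonneg_left (norm_nonneg _) hε (h v)

lemma H_diff (φ : ℝ → ℝ) (heven : ∀ u : ℝ, φ (-u) = φ u) (hc : Continuous φ)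
    (hint : Integrable φ) (a ε : ℝ) (hε : 0 < ε) :
    Hcauchy φ (a - Complex.I * ε) - Hcauchy φ (-a - Complex.I * ε) =
      ((∫ v : ℝ, (φ (a - v) - φ (a + v)) * v / (v ^ 2 + ε ^ 2) : ℝ) : ℂ) := by
  have h1 : Hcauchy φ (a - Complex.I * ε) =
      ∫ v : ℝ, (φ (a - v) : ℂ) / (v - Complex.I * ε) := by
    unfold Hcauchy
    rw [← integral_sub_left_eq_self _ volume a]
    congr 1; ext v; push_cast; congr 1; ring
  have h2 : Hcauchy φ (-a - Complex.I * ε) =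
      ∫ v : ℝ, (φ (a - v) : ℂ) / (-v - Complex.I * ε) := by
    unfold Hcauchy
    rw [← integral_sub_right_eq_self _ a]
    congr 1; ext v
    rw [← heven (v - a), neg_sub]; push_cast; congr 1; ring
  have n1 : ∀ v : ℝ, ε ≤ ‖(v : ℂ) - Complex.I * ε‖ := fun v => by
    have := Complex.abs_im_le_norm ((v : ℂ) - Complex.I * ε)
    simpa [abs_of_pos hε] using this
  have n2 : ∀ v : ℝ, ε ≤ ‖-(v : ℂ) - Complex.I * ε‖ := fun v => by
    have := Complex.abs_im_le_norm (-(v : ℂ) - Complex.I * ε)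
    simpa [abs_of_pos hε] using this
  have hi : Integrable (fun v => φ (a - v)) := hint.comp_sub_left a
  have hci : Continuous (fun v => φ (a - v)) := by fun_prop
  have i1 := int_div _ hi hci (fun v : ℝ => (v : ℂ) - Complex.I * ε) (by fun_prop) ε hε n1
  have i2 := int_div _ hi hci (fun v : ℝ => -(v : ℂ) - Complex.I * ε) (by fun_prop) ε hε n2
  have e : (fun v : ℝ => (φ (a - v) : ℂ) / (v - Complex.I * ε)
      - (φ (a - v) : ℂ) / (-v - Complex.I * ε)) =
      fun v : ℝ => ((2 * (φ (a - v) * v / (v ^ 2 + ε ^ 2)) : ℝ) : ℂ) := by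
    ext v
    have m1 : (v : ℂ) - Complex.I * ε ≠ 0 := norm_pos_iff.1 (hε.trans_le (n1 v))
    have m2 : -(v : ℂ) - Complex.I * ε ≠ 0 := norm_pos_iff.1 (hε.trans_le (n2 v))
    have m3 : (v : ℂ) ^ 2 + (ε : ℂ) ^ 2 = - (((v : ℂ) - Complex.I * ε) * (-(v : ℂ) - Complex.I * ε)) := by
      linear_combination ((ε : ℂ) ^ 2) * Complex.I_sq
    push_cast
    rw [m3]
    field_simp
    ring
  have i3 := i1.sub i2
  have i3' : Integrable (fun v : ℝ => ((2 * (φ (a - v) * v / (v ^ 2 + ε ^ 2)) : ℝ) : ℂ)) := by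
    rw [← e]; exact i3
  have i4 : Integrable (fun v : ℝ => 2 * (φ (a - v) * v / (v ^ 2 + ε ^ 2))) := by
    exact i3'.re
  have i5 : Integrable (fun v : ℝ => φ (a - v) * v / (v ^ 2 + ε ^ 2)) := by
    simpa using i4.const_mul (1 / 2)
  rw [h1, h2, ← integral_sub i1 i2, e, integral_complex_ofReal]
  congr 1
  have i6 := i5.comp_neg
  have e2 : (fun v : ℝ => (φ (a - v) - φ (a + v)) * v / (v ^ 2 + ε ^ 2)) =
      fun v => φ (a - v) * v / (v ^ 2 + ε ^ 2)
        + (fun v => φ (a - v) * v / (v ^ 2 + ε ^ 2)) (-v) := by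
    ext v; simp only [sub_neg_eq_add, neg_sq]; ring
  rw [e2, integral_add i5 i6, integral_neg_eq_self (fun v => φ (a - v) * v / (v ^ 2 + ε ^ 2)),
    integral_const_mul]
  ring

lemma lim_int (φ : ℝ → ℝ) (hpos : ∀ u : ℝ, 0 ≤ φ u) (hC1 : ContDiff ℝ 1 φ)
    (hint : Integrable φ) (a : ℝ) :
    Filter.Tendsto (fun ε : ℝ => ∫ v : ℝ, (φ (a - v) - φ (a + v)) * v / (v ^ 2 + ε ^ 2))
      (nhdsWithin 0 (Set.Ioi 0))
      (nhds (∫ v : ℝ, (φ (a - v) - φ (a + v)) * v / (v ^ 2))) := by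
  have hc := hC1.continuous
  obtain ⟨C, hC⟩ := (isCompact_Icc (a := a - 1) (b := a + 1)).exists_bound_of_continuousOn
    (hC1.continuous_deriv (by norm_num)).continuousOn
  have hlip : ∀ v, |v| ≤ 1 → |φ (a - v) - φ (a + v)| ≤ C * (2 * |v|) := by
    intro v hv
    rw [abs_le] at hv
    have := (convex_Icc (a - 1) (a + 1)).norm_image_sub_le_of_norm_deriv_le (f := φ) (C := C)
      (fun x _ => hC1.differentiable (by norm_num) x) hC
      (x := a + v) (y := a - v) ⟨by linarith, by linarith⟩ ⟨by linarith, by linarith⟩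
    rw [Real.norm_eq_abs, Real.norm_eq_abs] at this
    have e : |a - v - (a + v)| = 2 * |v| := by
      rw [show a - v - (a + v) = -(2 * v) by ring, abs_neg, abs_mul]; simp
    rwa [e] at this
  apply tendsto_integral_filter_of_dominated_convergence
    (fun v => (Set.Icc (-1 : ℝ) 1).indicator (fun _ => 2 * C) v + (φ (a - v) + φ (a + v)))
  · filter_upwards [self_mem_nhdsWithin] with ε hε
    have hε : 0 < ε := hε
    apply Continuous.aestronglyMeasurable
    apply Continuous.div (by fun_prop) (by fun_prop)
    intro v; positivity
  · filter_upwards [self_mem_nhdsWithin] with ε hε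
    have hε : 0 < ε := hε
    refine Filter.Eventually.of_forall fun v => ?_
    have hp : 0 < v ^ 2 + ε ^ 2 := by positivity
    have h1 := hpos (a - v)
    have h2 := hpos (a + v)
    rw [Real.norm_eq_abs, abs_div, abs_mul, abs_of_pos hp, div_le_iff₀ hp]
    by_cases hv : |v| ≤ 1
    · rw [Set.indicator_of_mem (by exact abs_le.1 hv)]
      have h3 := hlip v hv
      have hC0 : 0 ≤ C := (norm_nonneg _).trans (hC a ⟨by linarith, by linarith⟩)
      calc |φ (a - v) - φ (a + v)| * |v| ≤ C * (2 * |v|) * |v| := by gcongr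
        _ = 2 * C * v ^ 2 := by rw [← sq_abs v]; ring
        _ ≤ _ := by gcongr <;> nlinarith
    · have hv' := hv
      push Not at hv'
      rw [Set.indicator_of_notMem (by simpa [abs_le] using hv), zero_add]
      have h3 : |φ (a - v) - φ (a + v)| ≤ φ (a - v) + φ (a + v) := by
        rw [abs_le]; constructor <;> linarith
      have h4 : |v| ≤ v ^ 2 + ε ^ 2 := by rw [← sq_abs v]; nlinarith
      gcongr
  · apply Integrable.add
    · rw [integrable_indicator_iff measurableSet_Icc]
      exact integrableOn_const (by simp)
    · exact (hint.comp_sub_left a).add (hint.comp_add_left a)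
  · have : ∀ᵐ v : ℝ, v ≠ 0 := by simp [ae_iff]
    filter_upwards [this] with v hv
    apply Filter.Tendsto.mono_left _ nhdsWithin_le_nhds
    have : ContinuousAt (fun ε : ℝ => (φ (a - v) - φ (a + v)) * v / (v ^ 2 + ε ^ 2)) 0 := by
      apply ContinuousAt.div (by fun_prop) (by fun_prop)
      simp [hv]
    simpa [ContinuousAt] using this

theorem stmt9 (d : ℕ) (hd : 2 ≤ d) (φ : ℝ → ℝ) (Υ : ℝ≥0∞) (hΥ : 0 < Υ)
    (hpos : ∀ u : ℝ, 0 ≤ φ u)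
    (heven : ∀ u : ℝ, φ (-u) = φ u)
    (hC1 : ContDiff ℝ 1 φ)
    (hint : Integrable φ)
    (hint' : Integrable (deriv φ))
    (hmono : ∀ u : ℝ, 0 < u → ENNReal.ofReal u < Υ → deriv φ u < 0)
    (hsupp : ∀ u : ℝ, Υ ≤ ENNReal.ofReal |u| → φ u = 0) :
    ∀ k : EuclideanSpace ℝ (Fin d), k ≠ 0 →
      ∃ Dval : ℂ,
        Filter.Tendsto (fun γ : ℝ => Dcoulomb φ (γ : ℂ) k)
          (nhdsWithin 0 (Set.Ioi 0)) (nhds Dval) ∧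
        Dval.im = 0 ∧ 1 ≤ Dval.re := by
  intro k hk
  have hK : 0 < ‖k‖ := norm_pos_iff.2 hk
  set K := ‖k‖ with hKdef
  have hanti := phi_anti φ Υ hpos hC1 hmono hsupp
  have ha : 0 < K / 2 := by positivity
  have hl := lim_int φ hpos hC1 hint (K / 2)
  have hs : Filter.Tendsto (fun γ : ℝ => γ / (2 * K)) (nhdsWithin 0 (Set.Ioi 0))
      (nhdsWithin 0 (Set.Ioi 0)) := by
    apply tendsto_nhdsWithin_of_tendsto_nhds_of_eventually_within
    · apply Filter.Tendsto.mono_left _ nhdsWithin_le_nhds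
      have : Continuous (fun γ : ℝ => γ / (2 * K)) := by fun_prop
      simpa using this.tendsto 0
    · filter_upwards [self_mem_nhdsWithin] with γ hγ
      have hγ : 0 < γ := hγ
      exact div_pos hγ (by positivity)
  have hl2 := ((hl.comp hs).const_mul ((K ^ 2)⁻¹ / (2 * K))).const_add 1
  refine ⟨((1 + (K ^ 2)⁻¹ / (2 * K) *
    ∫ v : ℝ, (φ (K / 2 - v) - φ (K / 2 + v)) * v / (v ^ 2) : ℝ) : ℂ), ?_, ?_, ?_⟩
  · refine ((Complex.continuous_ofReal.tendsto _).comp hl2).congr' ?_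
    filter_upwards [self_mem_nhdsWithin] with γ hγ
    have hγ : 0 < γ := hγ
    have hKc : (K : ℂ) ≠ 0 := by exact_mod_cast hK.ne'
    have hd := H_diff φ heven hC1.continuous hint (K / 2) (γ / (2 * K)) (by positivity)
    have e1 : (-Complex.I * (γ : ℂ) + (K : ℂ) ^ 2) / (2 * (K : ℂ)) =
        ((K / 2 : ℝ) : ℂ) - Complex.I * ((γ / (2 * K) : ℝ) : ℂ) := by
      push_cast; field_simp; ring
    have e2 : (-Complex.I * (γ : ℂ) - (K : ℂ) ^ 2) / (2 * (K : ℂ)) =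
        -((K / 2 : ℝ) : ℂ) - Complex.I * ((γ / (2 * K) : ℝ) : ℂ) := by
      push_cast; field_simp; ring
    unfold Dcoulomb
    rw [← hKdef, e1, e2, hd]
    simp only [Function.comp]
    rw [Complex.ofReal_add, Complex.ofReal_mul]
    push_cast
    rfl
  · exact Complex.ofReal_im _
  · rw [Complex.ofReal_re]
    have : 0 ≤ ∫ v : ℝ, (φ (K / 2 - v) - φ (K / 2 + v)) * v / (v ^ 2) :=
      integral_nonneg fun v => div_nonneg (g_nonneg φ heven hanti _ ha v) (sq_nonneg v)
    have h2 : 0 ≤ (K ^ 2)⁻¹ / (2 * K) := by positivity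
    nlinarith [mul_nonneg h2 this]
end

section
/- Let d ≥ 2 be an integer and let φ : ℝ → [0,∞) be even, twice continuously differentiable with φ, φ', φ'' integrable and bounded, such that for some Υ ∈ (0,∞], φ'(u) < 0 for 0 < u < Υ and φ(u) = 0 for |u| ≥ Υ. Define D(λ,k) for k ≠ 0 and Re λ > 0 as the Coulomb dielectric function. Then for every compact set U ⊂ (−2Υ, 2Υ) there is a constant c_U > 0, independent of k, such that for all k ∈ ℝ^d with k ≠ 0 and all τ̃ ∈ U, the limit D(i τ̃ |k|, k) := lim_{γ→0⁺} D(γ + i τ̃ |k|, k) exists and satisfies |D(i τ̃ |k|, k)| ≥ c_U (1 + |k|^{-2}). -/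
open MeasureTheory ENNReal

open Set Filter Topology

lemma dominator (f : ℝ → ℝ) (hf : ContDiff ℝ 1 f) (hi : Integrable f) (hi' : Integrable (deriv f))
    (R : ℝ) : ∃ D : ℝ → ℝ, Integrable D ∧ ∀ v h : ℝ, |h| ≤ R → |f (v + h)| ≤ D v := by
  set L := ContinuousLinearMap.mul ℝ ℝ
  set χ : ℝ → ℝ := indicator (Icc (-R) R) 1
  have hχ : Integrable χ := by
    refine (integrable_indicator_iff measurableSet_Icc).2 ?_
    exact continuousOn_const.integrableOn_compact isCompact_Icc
  have hc := hχ.integrable_convolution L hi'.norm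
  refine ⟨fun v => |f v| + convolution χ (fun u => ‖deriv f u‖) L volume v, hi.abs.add hc, ?_⟩
  intro v h hh
  have h1 : f (v + h) - f v = ∫ u in v..(v+h), deriv f u := by
    rw [intervalIntegral.integral_deriv_eq_sub]
    · intro x _; exact (hf.differentiable (by norm_num)).differentiableAt
    · exact hi'.intervalIntegrable
  have h2 : |f (v + h) - f v| ≤ ∫ u in Icc (v - R) (v + R), ‖deriv f u‖ := by
    rw [h1]
    refine (intervalIntegral.norm_integral_le_integral_norm_uIoc (f := deriv f) (μ := volume)).trans ?_
    refine setIntegral_mono_set hi'.norm.integrableOn (Eventually.of_forall fun _ => norm_nonneg _) ?_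
    refine LE.le.eventuallyLE ?_
    intro u hu
    have := abs_le.1 hh
    rcases le_total 0 h with h0 | h0
    · rw [uIoc_of_le (by linarith)] at hu
      exact ⟨by linarith [hu.1], by linarith [hu.2]⟩
    · rw [uIoc_of_ge (by linarith)] at hu
      exact ⟨by linarith [hu.1], by linarith [hu.2]⟩
  have h3 : (∫ u in Icc (v - R) (v + R), ‖deriv f u‖)
      = convolution χ (fun u => ‖deriv f u‖) L volume v := by
    rw [convolution_def, ← integral_indicator measurableSet_Icc,
      ← integral_sub_left_eq_self _ volume v]
    congr 1
    ext t
    by_cases ht : t ∈ Icc (-R) R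
    · have : v - t ∈ Icc (v - R) (v + R) := ⟨by linarith [ht.2], by linarith [ht.1]⟩
      simp [χ, L, indicator_of_mem, ht, this, -mem_Icc]
    · have : v - t ∉ Icc (v - R) (v + R) := by
        intro h; apply ht; exact ⟨by linarith [h.2], by linarith [h.1]⟩
      simp [χ, L, indicator_of_notMem, ht, this, -mem_Icc]
  have h4 : |f (v + h)| ≤ |f v| + |f (v + h) - f v| := by
    calc |f (v+h)| = |f v + (f (v + h) - f v)| := by ring_nf
      _ ≤ _ := abs_add_le _ _
  show _ ≤ _ + _
  linarith

/-- majorant for odd quotients -/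
lemma quot_bound (C : ℝ) (g : ℝ → ℝ) (hg : Integrable g) :
    ∃ B : ℝ → ℝ, IntegrableOn B (Ioi 0) ∧ ∀ y s : ℝ, 0 < s → |y| ≤ C * s → |y| ≤ g s →
      |y / s| ≤ B s := by
  refine ⟨fun s => indicator (Icc 0 1) (fun _ => |C|) s + |g s|, ?_, ?_⟩
  · refine Integrable.integrableOn ?_
    refine Integrable.add ?_ hg.abs
    refine (integrable_indicator_iff measurableSet_Icc).2 ?_
    exact continuousOn_const.integrableOn_compact isCompact_Icc
  · intro y s hs h1 h2
    rw [abs_div, abs_of_pos hs]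
    by_cases h : s ≤ 1
    · have : s ∈ Icc (0:ℝ) 1 := ⟨hs.le, h⟩
      simp only [indicator_of_mem this]
      rw [div_le_iff₀ hs]
      have : 0 ≤ |g s| * s := by positivity
      have := mul_le_mul_of_nonneg_right (le_abs_self C) hs.le
      nlinarith
    · have : s ∉ Icc (0:ℝ) 1 := fun h' => h h'.2
      simp only [indicator_of_notMem this, zero_add]
      push Not at h
      rw [div_le_iff₀ hs]
      have := le_abs_self (g s)
      nlinarith [abs_nonneg (g s)]

lemma lip_of (f : ℝ → ℝ) (M : ℝ) (hd : Differentiable ℝ f) (hM : ∀ u, |deriv f u| ≤ M) (a b : ℝ) :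
    |f a - f b| ≤ M * |a - b| :=
  Convex.norm_image_sub_le_of_norm_deriv_le (fun x _ => hd x) (fun x _ => hM x) convex_univ
    (mem_univ b) (mem_univ a)

noncomputable def Pv (φ : ℝ → ℝ) (x : ℝ) : ℝ := ∫ s in Ioi (0:ℝ), (φ (x - s) - φ (x + s)) / s

lemma pv_int (φ : ℝ → ℝ) (M : ℝ) (hd : Differentiable ℝ φ) (hM : ∀ u, |deriv φ u| ≤ M)
    (hi : Integrable φ) (x : ℝ) :
    IntegrableOn (fun s => (φ (x - s) - φ (x + s)) / s) (Ioi 0) := by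
  obtain ⟨B, hB, hB'⟩ := quot_bound (2 * M) (fun s => |φ (x - s)| + |φ (x + s)|)
    ((hi.comp_sub_left x).abs.add (hi.comp_add_left x).abs)
  refine Integrable.mono' hB ?_ ?_
  · have hc := hd.continuous
    exact Measurable.aestronglyMeasurable (by fun_prop)
  · refine (ae_restrict_iff' measurableSet_Ioi).2 (Eventually.of_forall fun s hs => ?_)
    refine hB' _ s hs ?_ (abs_sub _ _)
    have := lip_of φ M hd hM (x - s) (x + s)
    have hs : 0 < s := hs
    rw [show x - s - (x + s) = -(2 * s) by ring, abs_neg, abs_of_pos (show 0 < 2 * s by linarith)] at this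
    linarith

lemma re_lim (φ : ℝ → ℝ) (M : ℝ) (hd : Differentiable ℝ φ) (hM : ∀ u, |deriv φ u| ≤ M)
    (hi : Integrable φ) (x : ℝ) :
    Tendsto (fun ε : ℝ => ∫ s : ℝ, φ (x - s) * (s / (s ^ 2 + ε ^ 2))) (𝓝[>] 0) (𝓝 (Pv φ x)) := by
  have hc := hd.continuous
  have key : ∀ ε : ℝ, 0 < ε → ∫ s : ℝ, φ (x - s) * (s / (s ^ 2 + ε ^ 2)) =
      ∫ s in Ioi (0:ℝ), (φ (x - s) - φ (x + s)) * (s / (s ^ 2 + ε ^ 2)) := by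
    intro ε hε
    have hI : Integrable (fun s => φ (x - s) * (s / (s ^ 2 + ε ^ 2))) := by
      have := (hi.comp_sub_left x).bdd_mul (f := fun s : ℝ => s / (s ^ 2 + ε ^ 2)) (c := 1 / ε) 
        (Measurable.aestronglyMeasurable (by fun_prop)) (Eventually.of_forall fun s => ?_)
      · exact this.congr (Eventually.of_forall fun s => mul_comm _ _)
      · rw [Real.norm_eq_abs, abs_div, abs_of_pos (show 0 < s ^ 2 + ε ^ 2 by positivity),
          div_le_div_iff₀ (by positivity) hε]
        nlinarith [sq_nonneg (|s| - ε), sq_abs s, abs_nonneg s]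
    rw [← intervalIntegral.integral_Iic_add_Ioi (b := 0) hI.integrableOn hI.integrableOn]
    have e := integral_comp_neg_Ioi 0 (fun s => φ (x - s) * (s / (s ^ 2 + ε ^ 2)))
    rw [neg_zero] at e
    rw [← e, ← integral_add]
    · congr 1
      ext s
      rw [sub_neg_eq_add, neg_sq]
      ring
    · exact hI.comp_neg.integrableOn
    · exact hI.integrableOn
  have : Tendsto (fun ε : ℝ => ∫ s in Ioi (0:ℝ), (φ (x - s) - φ (x + s)) * (s / (s ^ 2 + ε ^ 2)))
      (𝓝[>] 0) (𝓝 (Pv φ x)) := by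
    refine tendsto_integral_filter_of_dominated_convergence
      (fun s => ‖(φ (x - s) - φ (x + s)) / s‖) ?_ ?_ (pv_int φ M hd hM hi x).norm ?_
    · exact Eventually.of_forall fun ε => Measurable.aestronglyMeasurable (by fun_prop)
    · refine Eventually.of_forall fun ε => ?_
      refine (ae_restrict_iff' measurableSet_Ioi).2 (Eventually.of_forall fun s hs => ?_)
      have hs : 0 < s := hs
      rw [div_eq_mul_inv (φ (x - s) - φ (x + s)) s, norm_mul, norm_mul]
      refine mul_le_mul_of_nonneg_left ?_ (norm_nonneg _)
      rw [Real.norm_of_nonneg (by positivity), Real.norm_of_nonneg (by positivity),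
        div_le_iff₀ (by positivity), inv_mul_eq_div, le_div_iff₀ hs]
      nlinarith [sq_nonneg ε]
    · refine (ae_restrict_iff' measurableSet_Ioi).2 (Eventually.of_forall fun s hs => ?_)
      have hs : 0 < s := hs
      have hcont : ContinuousAt (fun ε : ℝ => (φ (x - s) - φ (x + s)) * (s / (s ^ 2 + ε ^ 2))) 0 := by
        refine continuousAt_const.mul (continuousAt_const.div (by fun_prop) ?_)
        positivity
      have := hcont.tendsto.mono_left (nhdsWithin_le_nhds (s := Ioi 0))
      convert this using 2
      field_simp
      ring
  refine this.congr' ?_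
  filter_upwards [self_mem_nhdsWithin] with ε hε
  exact (key ε hε).symm

lemma im_lim (φ : ℝ → ℝ) (M : ℝ) (hc : Continuous φ) (hM : ∀ u, |φ u| ≤ M) (x : ℝ) :
    Tendsto (fun ε : ℝ => ∫ s : ℝ, φ (x - s) * (ε / (s ^ 2 + ε ^ 2))) (𝓝[>] 0)
      (𝓝 (Real.pi * φ x)) := by
  have key : ∀ ε : ℝ, 0 < ε → ∫ s : ℝ, φ (x - s) * (ε / (s ^ 2 + ε ^ 2)) =
      ∫ t : ℝ, φ (x - ε * t) * (1 + t ^ 2)⁻¹ := by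
    intro ε hε
    have := Measure.integral_comp_mul_left (fun s => φ (x - s) * (ε / (s ^ 2 + ε ^ 2))) ε
    rw [abs_of_pos (by positivity), smul_eq_mul] at this
    rw [eq_inv_mul_iff_mul_eq₀ hε.ne'] at this
    rw [← this, ← integral_const_mul]
    congr 1
    ext t
    field_simp
    ring
  have : Tendsto (fun ε : ℝ => ∫ t : ℝ, φ (x - ε * t) * (1 + t ^ 2)⁻¹) (𝓝[>] 0)
      (𝓝 (∫ t : ℝ, φ x * (1 + t ^ 2)⁻¹)) := by
    refine tendsto_integral_filter_of_dominated_convergence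
      (fun t => M * (1 + t ^ 2)⁻¹) ?_ ?_ (integrable_inv_one_add_sq.const_mul M) ?_
    · exact Eventually.of_forall fun ε => Measurable.aestronglyMeasurable (by fun_prop)
    · refine Eventually.of_forall fun ε => Eventually.of_forall fun t => ?_
      rw [norm_mul, Real.norm_of_nonneg (show 0 ≤ (1 + t ^ 2)⁻¹ by positivity)]
      exact mul_le_mul_of_nonneg_right (hM _) (by positivity)
    · refine Eventually.of_forall fun t => ?_
      have hcont : Continuous (fun ε : ℝ => φ (x - ε * t) * (1 + t ^ 2)⁻¹) := by fun_prop
      have := (hcont.tendsto 0).mono_left (nhdsWithin_le_nhds (s := Ioi 0))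
      simpa using this
  rw [integral_const_mul, integral_univ_inv_one_add_sq, mul_comm] at this
  refine this.congr' ?_
  filter_upwards [self_mem_nhdsWithin] with ε hε
  exact (key ε hε).symm

lemma H_lim (φ : ℝ → ℝ) (M : ℝ) (hd : Differentiable ℝ φ) (hM0 : ∀ u, |φ u| ≤ M)
    (hM : ∀ u, |deriv φ u| ≤ M) (hi : Integrable φ) (x : ℝ) :
    Tendsto (fun ε : ℝ => Hcauchy φ ((x : ℂ) - Complex.I * ε)) (𝓝[>] 0)
      (𝓝 ((Pv φ x : ℂ) + Complex.I * ((Real.pi * φ x : ℝ) : ℂ))) := by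
  have hc := hd.continuous
  have h1 := (Complex.continuous_ofReal.tendsto _).comp (re_lim φ M hd hM hi x)
  have h2 := (Complex.continuous_ofReal.tendsto _).comp (im_lim φ M hc hM0 x)
  refine (h1.add (h2.const_mul Complex.I)).congr' ?_
  filter_upwards [self_mem_nhdsWithin] with ε hε
  have hε : 0 < ε := hε
  simp only [Function.comp]
  rw [Hcauchy, ← integral_sub_left_eq_self (fun u : ℝ => (φ u : ℂ) / ((x:ℂ) - Complex.I * ε - (u : ℂ))) volume x, ← integral_complex_ofReal,
    ← integral_complex_ofReal, ← integral_const_mul, ← integral_add]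
  · congr 1
    ext s
    have e1 : ((s:ℂ) ^ 2 + (ε:ℂ) ^ 2) ≠ 0 := by
      norm_cast; positivity
    have e2 : ((s:ℂ) - Complex.I * ε) ≠ 0 := by
      intro h
      apply e1
      have : ((s:ℂ) ^ 2 + (ε:ℂ) ^ 2) = (s - Complex.I * ε) * (s + Complex.I * ε) := by
        ring_nf; simp
      rw [this, h, zero_mul]
    have e3 : (x:ℂ) - Complex.I * ε - ((x - s : ℝ) : ℂ) = s - Complex.I * ε := by
      push_cast; ring
    rw [e3]
    push_cast
    rw [eq_div_iff e2]
    field_simp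
    linear_combination (-(φ (x - s) : ℂ) * ε ^ 2) * Complex.I_sq
  · refine Integrable.ofReal (𝕜 := ℂ) (f := fun s => φ (x - s) * (s / (s ^ 2 + ε ^ 2))) ?_
    have := (hi.comp_sub_left x).bdd_mul (f := fun s : ℝ => s / (s ^ 2 + ε ^ 2)) (c := 1 / ε) 
      (Measurable.aestronglyMeasurable (by fun_prop)) (Eventually.of_forall fun s => ?_)
    · exact this.congr (Eventually.of_forall fun s => mul_comm _ _)
    · rw [Real.norm_eq_abs, abs_div, abs_of_pos (show 0 < s ^ 2 + ε ^ 2 by positivity),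
        div_le_div_iff₀ (by positivity) hε]
      nlinarith [sq_nonneg (|s| - ε), sq_abs s, abs_nonneg s]
  · refine Integrable.const_mul (Integrable.ofReal (𝕜 := ℂ) (f := fun s => φ (x - s) * (ε / (s ^ 2 + ε ^ 2))) ?_) _
    have := (hi.comp_sub_left x).bdd_mul (f := fun s : ℝ => ε / (s ^ 2 + ε ^ 2)) (c := 1 / ε) 
      (Measurable.aestronglyMeasurable (by fun_prop)) (Eventually.of_forall fun s => ?_)
    · exact this.congr (Eventually.of_forall fun s => mul_comm _ _)
    · rw [Real.norm_of_nonneg (by positivity), div_le_div_iff₀ (by positivity) hε]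
      nlinarith [sq_nonneg s]

noncomputable def psi (φ : ℝ → ℝ) (p : ℝ × ℝ) (v : ℝ) : ℝ :=
  ∫ t in (0:ℝ)..1, deriv φ (v + ((p.2 - p.1) / 2 + t * p.1))

lemma psi_eq (φ : ℝ → ℝ) (hd : Differentiable ℝ φ) (hc : Continuous (deriv φ)) (r τ v : ℝ) :
    r * psi φ (r, τ) v = φ (v + (τ + r) / 2) - φ (v + (τ - r) / 2) := by
  have h : ∫ t in (0:ℝ)..1, deriv φ (v + ((τ - r) / 2 + t * r)) * r
      = φ (v + ((τ - r) / 2 + 1 * r)) - φ (v + ((τ - r) / 2 + 0 * r)) := by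
    refine intervalIntegral.integral_eq_sub_of_hasDerivAt
      (f := fun t => φ (v + ((τ - r) / 2 + t * r))) ?_ ?_
    · intro t _
      have h1 : HasDerivAt (fun t : ℝ => v + ((τ - r) / 2 + t * r)) r t := by
        have := (((hasDerivAt_id t).mul_const r).const_add ((τ - r) / 2)).const_add v
        simpa using this
      exact (hd _).hasDerivAt.comp t h1
    · exact Continuous.intervalIntegrable (by fun_prop) _ _
  rw [intervalIntegral.integral_mul_const] at h
  rw [psi, mul_comm, h]
  congr 2 <;> ring

lemma psi_cont (φ : ℝ → ℝ) (hc : Continuous (deriv φ)) :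
    Continuous (fun q : (ℝ × ℝ) × ℝ => psi φ q.1 q.2) := by
  unfold psi
  refine intervalIntegral.continuous_parametric_intervalIntegral_of_continuous' ?_ 0 1
  simp only [Function.uncurry_def]
  fun_prop

lemma psi_lip (φ : ℝ → ℝ) (M : ℝ) (hd : Differentiable ℝ (deriv φ))
    (hM : ∀ u, |deriv (deriv φ) u| ≤ M) (p : ℝ × ℝ) (s : ℝ) (hs : 0 < s) :
    |psi φ p (-s) - psi φ p s| ≤ 2 * M * s := by
  have hc := hd.continuous
  rw [psi, psi, ← intervalIntegral.integral_sub]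
  · have := intervalIntegral.norm_integral_le_of_norm_le_const (a := 0) (b := 1) (C := 2 * M * s)
      (f := fun t => deriv φ (-s + ((p.2 - p.1) / 2 + t * p.1)) -
        deriv φ (s + ((p.2 - p.1) / 2 + t * p.1))) ?_
    · simpa using this
    · intro t _
      have := lip_of (deriv φ) M hd hM (-s + ((p.2 - p.1) / 2 + t * p.1))
        (s + ((p.2 - p.1) / 2 + t * p.1))
      rw [show -s + ((p.2 - p.1) / 2 + t * p.1) - (s + ((p.2 - p.1) / 2 + t * p.1)) = -(2 * s) by ring,
        abs_neg, abs_of_pos (show 0 < 2 * s by linarith)] at this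
      rw [Real.norm_eq_abs]
      linarith
  · exact Continuous.intervalIntegrable (by fun_prop) _ _
  · exact Continuous.intervalIntegrable (by fun_prop) _ _

lemma psi_dom (φ : ℝ → ℝ) (hC2 : ContDiff ℝ 2 φ) (hi : Integrable (deriv φ))
    (hi' : Integrable (deriv (deriv φ))) (R : ℝ) :
    ∃ D : ℝ → ℝ, Integrable D ∧ ∀ p : ℝ × ℝ, |p.1| ≤ R → |p.2| ≤ R → ∀ v, |psi φ p v| ≤ D v := by
  have h1 : ContDiff ℝ 1 (deriv φ) := by
    have : ContDiff ℝ (1 + 1) φ := by simpa [one_add_one_eq_two] using hC2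
    exact (contDiff_succ_iff_deriv.1 this).2.2
  obtain ⟨D, hD, hD'⟩ := dominator (deriv φ) h1 hi hi' R
  refine ⟨D, hD, ?_⟩
  intro p hp1 hp2 v
  have := intervalIntegral.norm_integral_le_of_norm_le_const (a := 0) (b := 1) (C := D v)
      (f := fun t => deriv φ (v + ((p.2 - p.1) / 2 + t * p.1))) ?_
  · simpa [psi] using this
  · intro t ht
    rw [uIoc_of_le zero_le_one] at ht
    refine hD' v _ ?_
    rw [abs_le] at *
    obtain ⟨h1, h2⟩ := ht
    constructor <;> cases le_total 0 p.1 <;> nlinarith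

noncomputable def Gre (φ : ℝ → ℝ) (p : ℝ × ℝ) : ℝ :=
  ∫ s in Ioi (0:ℝ), (psi φ p (-s) - psi φ p s) / s

lemma psi_bound (φ : ℝ → ℝ) (M : ℝ) (hC2 : ContDiff ℝ 2 φ) (hi : Integrable (deriv φ))
    (hi' : Integrable (deriv (deriv φ))) (hM : ∀ u, |deriv (deriv φ) u| ≤ M) (R : ℝ) :
    ∃ B : ℝ → ℝ, IntegrableOn B (Ioi 0) ∧ ∀ p : ℝ × ℝ, |p.1| ≤ R → |p.2| ≤ R → ∀ s, 0 < s →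
      |(psi φ p (-s) - psi φ p s) / s| ≤ B s := by
  obtain ⟨D, hD, hD'⟩ := psi_dom φ hC2 hi hi' R
  obtain ⟨B, hB, hB'⟩ := quot_bound (2 * M) (fun s => D (-s) + D s) (hD.comp_neg.add hD)
  refine ⟨B, hB, fun p h1 h2 s hs => hB' _ s hs ?_ ?_⟩
  · have h1 : ContDiff ℝ (1+1) φ := by simpa [one_add_one_eq_two] using hC2
    exact psi_lip φ M ((contDiff_succ_iff_deriv.1 h1).2.2.differentiable (by norm_num)) hM p s hs
  · exact (abs_sub _ _).trans (add_le_add (hD' p h1 h2 _) (hD' p h1 h2 _))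

lemma meas_quot (φ : ℝ → ℝ) (hc : Continuous (deriv φ)) (p : ℝ × ℝ) :
    Measurable (fun s => (psi φ p (-s) - psi φ p s) / s) := by
  have hpc : Continuous (fun v => psi φ p v) :=
    (psi_cont φ hc).comp (continuous_const.prodMk continuous_id)
  have := hpc.measurable
  fun_prop

lemma Gre_int (φ : ℝ → ℝ) (M : ℝ) (hC2 : ContDiff ℝ 2 φ) (hi : Integrable (deriv φ))
    (hi' : Integrable (deriv (deriv φ))) (hM : ∀ u, |deriv (deriv φ) u| ≤ M) (p : ℝ × ℝ) :
    IntegrableOn (fun s => (psi φ p (-s) - psi φ p s) / s) (Ioi 0) := by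
  obtain ⟨B, hB, hB'⟩ := psi_bound φ M hC2 hi hi' hM (max |p.1| |p.2|)
  refine Integrable.mono' hB (meas_quot φ (hC2.continuous_deriv (by norm_num)) p).aestronglyMeasurable ?_
  exact (ae_restrict_iff' measurableSet_Ioi).2 (Eventually.of_forall fun s hs =>
    hB' p (le_max_left _ _) (le_max_right _ _) s hs)

lemma Gre_cont (φ : ℝ → ℝ) (M : ℝ) (hC2 : ContDiff ℝ 2 φ) (hi : Integrable (deriv φ))
    (hi' : Integrable (deriv (deriv φ))) (hM : ∀ u, |deriv (deriv φ) u| ≤ M) (R : ℝ) :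
    ContinuousOn (Gre φ) {p | |p.1| ≤ R ∧ |p.2| ≤ R} := by
  obtain ⟨B, hB, hB'⟩ := psi_bound φ M hC2 hi hi' hM R
  have hc := hC2.continuous_deriv (by norm_num)
  unfold Gre
  refine continuousOn_of_dominated (bound := B) ?_ ?_ hB ?_
  · intro p _
    exact (meas_quot φ hc p).aestronglyMeasurable
  · intro p hp
    exact (ae_restrict_iff' measurableSet_Ioi).2 (Eventually.of_forall fun s hs =>
      hB' p hp.1 hp.2 s hs)
  · refine Eventually.of_forall fun s => Continuous.continuousOn ?_
    have h (v : ℝ) : Continuous (fun p => psi φ p v) :=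
      (psi_cont φ hc).comp (continuous_id.prodMk continuous_const)
    exact ((h _).sub (h _)).div_const s

lemma Gre_eq (φ : ℝ → ℝ) (M : ℝ) (hC2 : ContDiff ℝ 2 φ) (hi : Integrable φ)
    (hM : ∀ u, |deriv φ u| ≤ M) (r τ : ℝ) :
    r * Gre φ (r, τ) = Pv φ ((τ + r) / 2) - Pv φ ((τ - r) / 2) := by
  have hd : Differentiable ℝ φ := hC2.differentiable (by norm_num)
  have hc := hC2.continuous_deriv (by norm_num)
  rw [Gre, Pv, Pv, ← integral_sub (pv_int φ M hd hM hi _) (pv_int φ M hd hM hi _),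
    ← integral_const_mul]
  congr 1
  ext s
  rw [← mul_div_assoc, mul_sub, psi_eq φ hd hc, psi_eq φ hd hc]
  rw [show -s + (τ + r) / 2 = (τ + r) / 2 - s by ring, show -s + (τ - r) / 2 = (τ - r) / 2 - s by ring,
    add_comm s, add_comm s]
  ring

noncomputable def Gf (φ : ℝ → ℝ) (p : ℝ × ℝ) : ℂ :=
  ((p.1 ^ 2 + Gre φ p / 2 : ℝ) : ℂ) + Complex.I * ((Real.pi * psi φ p 0 / 2 : ℝ) : ℂ)

lemma Gf_re (φ : ℝ → ℝ) (p : ℝ × ℝ) : (Gf φ p).re = p.1 ^ 2 + Gre φ p / 2 := by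
  rw [Gf, Complex.add_re, Complex.ofReal_re, Complex.I_mul_re, Complex.ofReal_im]; ring

lemma Gf_im (φ : ℝ → ℝ) (p : ℝ × ℝ) : (Gf φ p).im = Real.pi * psi φ p 0 / 2 := by
  rw [Gf, Complex.add_im, Complex.ofReal_im, Complex.I_mul_im, Complex.ofReal_re]; ring

lemma Gf_cont (φ : ℝ → ℝ) (M : ℝ) (hC2 : ContDiff ℝ 2 φ) (hi : Integrable (deriv φ))
    (hi' : Integrable (deriv (deriv φ))) (hM : ∀ u, |deriv (deriv φ) u| ≤ M) (R : ℝ) :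
    ContinuousOn (Gf φ) {p | |p.1| ≤ R ∧ |p.2| ≤ R} := by
  have h1 := Gre_cont φ M hC2 hi hi' hM R
  have h2 : Continuous (fun p => psi φ p 0) :=
      (psi_cont φ (hC2.continuous_deriv (by norm_num))).comp (continuous_id.prodMk continuous_const)
  unfold Gf
  refine ContinuousOn.add ?_ (Continuous.continuousOn (by fun_prop))
  refine Complex.continuous_ofReal.comp_continuousOn ?_
  exact (Continuous.continuousOn (by fun_prop)).add (h1.div_const 2)

lemma D_lim {d : ℕ} (φ : ℝ → ℝ) (M : ℝ) (hC2 : ContDiff ℝ 2 φ) (hM0 : ∀ u, |φ u| ≤ M)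
    (hM : ∀ u, |deriv φ u| ≤ M) (hi : Integrable φ) (k : EuclideanSpace ℝ (Fin d)) (hk : k ≠ 0)
    (τ : ℝ) :
    Tendsto (fun γ : ℝ => Dcoulomb φ ((γ : ℂ) + Complex.I * (τ * ‖k‖ : ℝ)) k)
      (𝓝[>] 0) (𝓝 (Gf φ (‖k‖, τ) / (‖k‖ : ℂ) ^ 2)) := by
  have hd : Differentiable ℝ φ := hC2.differentiable (by norm_num)
  have hc := hC2.continuous_deriv (by norm_num)
  have hr : 0 < ‖k‖ := norm_pos_iff.2 hk
  unfold Dcoulomb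
  set r := ‖k‖
  have hrc : (r : ℂ) ≠ 0 := by exact_mod_cast hr.ne'
  have hε : Tendsto (fun γ : ℝ => γ / (2 * r)) (𝓝[>] 0) (𝓝[>] 0) := by
    refine tendsto_nhdsWithin_iff.2 ⟨?_, ?_⟩
    · have : Continuous (fun γ : ℝ => γ / (2 * r)) := by fun_prop
      have := (this.tendsto 0).mono_left (nhdsWithin_le_nhds (s := Ioi 0))
      simpa using this
    · filter_upwards [self_mem_nhdsWithin] with γ hγ
      have : 0 < γ := hγ
      exact div_pos this (by positivity)
  have hp := (H_lim φ M hd hM0 hM hi ((τ + r) / 2)).comp hε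
  have hm := (H_lim φ M hd hM0 hM hi ((τ - r) / 2)).comp hε
  have := ((hp.sub hm).const_mul (((r : ℂ) ^ 2)⁻¹ / (2 * (r : ℂ)))).const_add 1
  convert this using 2
  · simp only [Function.comp]
    congr 4
    · push_cast
      field_simp
      linear_combination (-(τ : ℂ) * r) * Complex.I_sq
    · push_cast
      field_simp
      linear_combination (-(τ : ℂ) * r) * Complex.I_sq
  · have e1 := Gre_eq φ M hC2 hi hM r τ
    have e2 := psi_eq φ hd hc r τ 0
    rw [zero_add, zero_add] at e2
    have e1' : (r : ℂ) * Gre φ (r, τ) = Pv φ ((τ + r) / 2) - Pv φ ((τ - r) / 2) := by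
      exact_mod_cast e1
    have e2' : (r : ℂ) * psi φ (r, τ) 0 = φ ((τ + r) / 2) - φ ((τ - r) / 2) := by
      exact_mod_cast e2
    rw [Gf]
    push_cast
    field_simp
    linear_combination e1' + Complex.I * Real.pi * e2'

lemma dodd (φ : ℝ → ℝ) (heven : ∀ u : ℝ, φ (-u) = φ u) (u : ℝ) : deriv φ (-u) = - deriv φ u := by
  have h := deriv_comp_neg φ u
  have : (fun x => φ (-x)) = φ := funext heven
  rw [this] at h
  rw [h, neg_neg]

lemma dnonpos (φ : ℝ → ℝ) (Υ : ℝ≥0∞) (hpos : ∀ u : ℝ, 0 ≤ φ u)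
    (hmono : ∀ u : ℝ, 0 < u → ENNReal.ofReal u < Υ → deriv φ u < 0)
    (hsupp : ∀ u : ℝ, Υ ≤ ENNReal.ofReal |u| → φ u = 0) (u : ℝ) (hu : 0 < u) : deriv φ u ≤ 0 := by
  by_cases h : ENNReal.ofReal u < Υ
  · exact (hmono u hu h).le
  · have h0 : φ u = 0 := hsupp u (by rw [abs_of_pos hu]; exact not_lt.1 h)
    have : IsLocalMin φ u := Eventually.of_forall fun v => by rw [h0]; exact hpos v
    exact this.deriv_eq_zero.le

lemma mono_abs (φ : ℝ → ℝ) (hd : Differentiable ℝ φ) (heven : ∀ u : ℝ, φ (-u) = φ u)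
    (hn : ∀ u : ℝ, 0 < u → deriv φ u ≤ 0) (a b : ℝ) (h : |a| ≤ |b|) : φ b ≤ φ a := by
  have hab (x : ℝ) : φ |x| = φ x := by
    rcases abs_choice x with h | h <;> rw [h]
    exact heven x
  have : AntitoneOn φ (Ici 0) := antitoneOn_of_deriv_nonpos (convex_Ici 0) hd.continuous.continuousOn
    hd.differentiableOn (by intro x hx; rw [interior_Ici] at hx; exact hn x hx)
  rw [← hab a, ← hab b]
  exact this (abs_nonneg a) (abs_nonneg b) h

lemma Gre_nonneg (φ : ℝ → ℝ) (hd : Differentiable ℝ φ) (hc : Continuous (deriv φ))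
    (hm : ∀ a b : ℝ, |a| ≤ |b| → φ b ≤ φ a) (r τ : ℝ) (hr : 0 < r) (hτ : |τ| ≤ r) :
    0 ≤ Gre φ (r, τ) := by
  refine setIntegral_nonneg measurableSet_Ioi fun s hs => ?_
  have hs : 0 < s := hs
  refine div_nonneg ?_ hs.le
  refine nonneg_of_mul_nonneg_right (a := r) ?_ hr
  rw [mul_sub, psi_eq φ hd hc, psi_eq φ hd hc]
  have := abs_le.1 hτ
  have h1 : φ (s + (τ + r) / 2) ≤ φ (-s + (τ + r) / 2) := by
    apply hm
    apply abs_le_abs <;> linarith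
  have h2 : φ (-s + (τ - r) / 2) ≤ φ (s + (τ - r) / 2) := by
    apply hm
    rw [← abs_neg (-s + _)]
    apply abs_le_abs <;> linarith
  linarith

lemma Gre_pos (φ : ℝ → ℝ) (Υ : ℝ≥0∞) (hΥ : 0 < Υ) (heven : ∀ u : ℝ, φ (-u) = φ u)
    (hmono : ∀ u : ℝ, 0 < u → ENNReal.ofReal u < Υ → deriv φ u < 0)
    (hn : ∀ u : ℝ, 0 < u → deriv φ u ≤ 0)
    (hI : IntegrableOn (fun s => (psi φ (0,0) (-s) - psi φ (0,0) s) / s) (Ioi 0)) :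
    0 < Gre φ (0, 0) := by
  have hp (v : ℝ) : psi φ (0,0) v = deriv φ v := by simp [psi]
  have he (s : ℝ) : (psi φ (0,0) (-s) - psi φ (0,0) s) / s = (-2 * deriv φ s) / s := by
    rw [hp, hp, dodd φ heven]; ring
  rw [Gre, setIntegral_pos_iff_support_of_nonneg_ae _ hI]
  · obtain ⟨a, ha, ha'⟩ := ENNReal.lt_iff_exists_nnreal_btwn.1 hΥ
    have ha0 : (0:ℝ) < a := by exact_mod_cast ha
    refine lt_of_lt_of_le (b := volume (Ioo (0:ℝ) a)) ?_ (measure_mono ?_)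
    · simpa using ha0
    · intro s hs
      refine ⟨?_, hs.1⟩
      rw [Function.mem_support, he]
      have h0 : s ≠ 0 := hs.1.ne'
      have := hmono s hs.1 (lt_of_le_of_lt (by
        rw [← ENNReal.ofReal_coe_nnreal]; exact ENNReal.ofReal_le_ofReal hs.2.le) ha')
      exact div_ne_zero (mul_ne_zero (by norm_num) this.ne) h0
  · refine (ae_restrict_iff' measurableSet_Ioi).2 (Eventually.of_forall fun s hs => ?_)
    show 0 ≤ (psi φ (0, 0) (-s) - psi φ (0, 0) s) / s
    rw [he]
    have hs : 0 < s := hs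
    exact div_nonneg (by have := hn s hs; linarith) hs.le

lemma psi_ne (φ : ℝ → ℝ) (hc : Continuous (deriv φ)) (Υ : ℝ≥0∞) (heven : ∀ u : ℝ, φ (-u) = φ u)
    (hmono : ∀ u : ℝ, 0 < u → ENNReal.ofReal u < Υ → deriv φ u < 0)
    (hn : ∀ u : ℝ, 0 < u → deriv φ u ≤ 0) (r τ : ℝ) (hr : 0 ≤ r) (hτ : r < |τ|)
    (hT : ENNReal.ofReal |τ| < 2 * Υ) : psi φ (r, τ) 0 ≠ 0 := by
  have hT' : ENNReal.ofReal (|τ| / 2) < Υ := by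
    by_contra h
    push Not at h
    have h2 : 2 * Υ ≤ 2 * ENNReal.ofReal (|τ| / 2) := by gcongr
    have h3 : 2 * ENNReal.ofReal (|τ| / 2) = ENNReal.ofReal |τ| := by
      rw [← ENNReal.ofReal_ofNat, ← ENNReal.ofReal_mul (by norm_num)]
      congr 1; ring
    rw [h3] at h2
    exact absurd hT (not_lt.2 h2)
  have hmono' : ∀ u : ℝ, 0 < u → u ≤ |τ| / 2 → deriv φ u < 0 := fun u hu hu' =>
    hmono u hu ((ENNReal.ofReal_le_ofReal hu').trans_lt hT')
  rcases le_total 0 τ with h0 | h0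
  · rw [abs_of_nonneg h0] at *
    have : 0 < ∫ t in (0:ℝ)..1, - deriv φ (0 + ((τ - r) / 2 + t * r)) := by
      refine intervalIntegral.integral_pos one_pos (by fun_prop) ?_ ⟨0, ⟨le_rfl, zero_le_one⟩, ?_⟩
      · intro t ht
        have := mul_nonneg ht.1.le hr
        have := hn (0 + ((τ - r) / 2 + t * r)) (by linarith)
        linarith
      · have := hmono' (0 + ((τ - r) / 2 + 0 * r)) (by linarith) (by linarith)
        linarith
    rw [intervalIntegral.integral_neg] at this
    unfold psi
    simp only
    linarith
  · rw [abs_of_nonpos h0] at *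
    have hd' (x : ℝ) : deriv φ x = - deriv φ (-x) := by rw [dodd φ heven, neg_neg]
    have : 0 < ∫ t in (0:ℝ)..1, deriv φ (0 + ((τ - r) / 2 + t * r)) := by
      refine intervalIntegral.integral_pos one_pos (by fun_prop) ?_ ⟨1, ⟨zero_le_one, le_rfl⟩, ?_⟩
      · intro t ht
        have := mul_le_mul_of_nonneg_right ht.2 hr
        rw [hd']
        have := hn (-(0 + ((τ - r) / 2 + t * r))) (by linarith)
        linarith
      · rw [hd']
        have := hmono' (-(0 + ((τ - r) / 2 + 1 * r))) (by linarith) (by linarith)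
        linarith
    exact this.ne'

theorem stmt10 (d : ℕ) (hd : 2 ≤ d) (φ : ℝ → ℝ) (Υ : ℝ≥0∞) (hΥ : 0 < Υ)
    (hpos : ∀ u : ℝ, 0 ≤ φ u)
    (heven : ∀ u : ℝ, φ (-u) = φ u)
    (hC2 : ContDiff ℝ 2 φ)
    (hint : Integrable φ)
    (hint' : Integrable (deriv φ))
    (hint'' : Integrable (deriv (deriv φ)))
    (hbdd : ∃ M : ℝ, ∀ u : ℝ, |φ u| + |deriv φ u| + |deriv (deriv φ) u| ≤ M)
    (hmono : ∀ u : ℝ, 0 < u → ENNReal.ofReal u < Υ → deriv φ u < 0)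
    (hsupp : ∀ u : ℝ, Υ ≤ ENNReal.ofReal |u| → φ u = 0) :
    ∀ U : Set ℝ, IsCompact U → (∀ τ ∈ U, ENNReal.ofReal |τ| < 2 * Υ) →
      ∃ cU : ℝ, 0 < cU ∧
        ∀ k : EuclideanSpace ℝ (Fin d), k ≠ 0 → ∀ τ ∈ U,
          ∃ Dval : ℂ,
            Filter.Tendsto
              (fun γ : ℝ => Dcoulomb φ ((γ : ℂ) + Complex.I * (τ * ‖k‖ : ℝ)) k)
              (nhdsWithin 0 (Set.Ioi 0)) (nhds Dval) ∧
            cU * (1 + (‖k‖ ^ 2)⁻¹) ≤ ‖Dval‖ := by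
  intro U hU hUΥ
  obtain ⟨M, hM⟩ := hbdd
  have hM0 : ∀ u, |φ u| ≤ M := fun u => by
    linarith [hM u, abs_nonneg (deriv φ u), abs_nonneg (deriv (deriv φ) u)]
  have hM1 : ∀ u, |deriv φ u| ≤ M := fun u => by
    linarith [hM u, abs_nonneg (φ u), abs_nonneg (deriv (deriv φ) u)]
  have hM2 : ∀ u, |deriv (deriv φ) u| ≤ M := fun u => by
    linarith [hM u, abs_nonneg (φ u), abs_nonneg (deriv φ u)]
  have hd' : Differentiable ℝ φ := hC2.differentiable (by norm_num)
  have hc := hC2.continuous_deriv (by norm_num)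
  have hn := dnonpos φ Υ hpos hmono hsupp
  have hm := mono_abs φ hd' heven hn
  obtain ⟨R0, hR0⟩ := hU.isBounded.exists_norm_le
  set R := max 1 R0 with hR
  have hR1 : 1 ≤ R := le_max_left _ _
  have hRU : ∀ τ ∈ U, |τ| ≤ R := fun τ hτ => (hR0 τ hτ).trans (le_max_right _ _)
  have hne : ∀ p ∈ Icc (0:ℝ) R ×ˢ U, Gf φ p ≠ 0 := by
    rintro ⟨r, τ⟩ ⟨hr, hτ⟩ h0
    simp only at hr hτ
    by_cases h : r < |τ|
    · have him := Gf_im φ (r, τ)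
      rw [h0, Complex.zero_im] at him
      have := psi_ne φ hc Υ heven hmono hn r τ hr.1 h (hUΥ τ hτ)
      have hpi := Real.pi_pos.ne'
      apply this
      have : Real.pi * psi φ (r, τ) 0 = 0 := by linarith
      exact (mul_eq_zero.1 this).resolve_left hpi
    · push Not at h
      have hre := Gf_re φ (r, τ)
      rw [h0, Complex.zero_re] at hre
      rcases hr.1.eq_or_lt with h1 | h1
      · subst h1
        have hτ0 : τ = 0 := abs_eq_zero.1 (le_antisymm h (abs_nonneg _))
        subst hτ0
        have := Gre_pos φ Υ hΥ heven hmono hn (Gre_int φ M hC2 hint' hint'' hM2 (0,0))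
        simp only at hre
        linarith
      · have := Gre_nonneg φ hd' hc hm r τ h1 h
        simp only at hre
        nlinarith
  have hcont : ContinuousOn (fun p => ‖Gf φ p‖) (Icc (0:ℝ) R ×ˢ U) := by
    refine ((Gf_cont φ M hC2 hint' hint'' hM2 R).mono ?_).norm
    rintro ⟨r, τ⟩ ⟨hr, hτ⟩
    exact ⟨by rw [abs_of_nonneg hr.1]; exact hr.2, hRU τ hτ⟩
  obtain ⟨m, hm0, hmin⟩ : ∃ m : ℝ, 0 < m ∧ ∀ p ∈ Icc (0:ℝ) R ×ˢ U, m ≤ ‖Gf φ p‖ := by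
    rcases (Icc (0:ℝ) R ×ˢ U).eq_empty_or_nonempty with he | hne'
    · exact ⟨1, one_pos, by simp [he]⟩
    · obtain ⟨p, hp, hmin⟩ := (isCompact_Icc.prod hU).exists_isMinOn hne' hcont
      exact ⟨_, norm_pos_iff.2 (hne p hp), fun q hq => hmin hq⟩
  refine ⟨min (1/2) (m / (1 + R ^ 2)), by positivity, ?_⟩
  intro k hk τ hτ
  refine ⟨_, D_lim φ M hC2 hM0 hM1 hint k hk τ, ?_⟩
  have hr : 0 < ‖k‖ := norm_pos_iff.2 hk
  set r := ‖k‖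
  rw [norm_div, norm_pow, Complex.norm_real, Real.norm_of_nonneg hr.le, le_div_iff₀ (by positivity)]
  have e : (1 + (r ^ 2)⁻¹) * r ^ 2 = r ^ 2 + 1 := by field_simp
  rw [mul_assoc, e]
  by_cases hrR : r ≤ R
  · have h1 := hmin (r, τ) ⟨⟨hr.le, hrR⟩, hτ⟩
    calc min (1/2) (m / (1 + R ^ 2)) * (r ^ 2 + 1) ≤ (m / (1 + R ^ 2)) * (R ^ 2 + 1) := by
          gcongr
          exact min_le_right _ _
      _ = m := by field_simp; ring
      _ ≤ _ := h1
  · push Not at hrR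
    have h1 := Gre_nonneg φ hd' hc hm r τ hr ((hRU τ hτ).trans hrR.le)
    have h2 := Complex.abs_re_le_norm (Gf φ (r, τ))
    rw [Gf_re] at h2
    have h3 := (le_abs_self _).trans h2
    simp only at h3
    have h4 : min (1/2) (m / (1 + R ^ 2)) * (r ^ 2 + 1) ≤ (1/2) * (r ^ 2 + 1) := by
      gcongr
      exact min_le_left _ _
    nlinarith
end
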